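/- arXiv:2511.06978 — 2 statements merged into one kernel-verified Lean document; each statement's English description precedes it below -/
import Mathlib

section
/- Let a > 0 and let F : ℂ → ℂ be holomorphic on the open strip S = {z ∈ ℂ : |Im z| < a}, 2π-periodic (F(z + 2π) = F(z) for all z ∈ S), and bounded on S by M. Let f be the restriction of F to ℝ. Then for every b with 0 < b < a and every k ∈ ℤ, the Fourier coefficients satisfy |f̂(k)| ≤ M e^{−b|k|}; in particular the Fourier coefficients of f decay exponentially. -/
open MeasureTheory Real Complex

/-- The `k`-th Fourier coefficient of a `2π`-periodic function `h : ℝ → ℂ`: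
`ĥ(k) = (1/(2π)) ∫_{-π}^{π} h(θ) e^{-ikθ} dθ`. -/
noncomputable def fourierCoef (h : ℝ → ℂ) (k : ℤ) : ℂ :=
  (1 / (2 * Real.pi : ℂ)) * ∫ θ in (-Real.pi)..Real.pi, h θ * Complex.exp (-Complex.I * k * θ)

/-- The integral over a period of a periodic function, holomorphic on a strip, does not change
when the segment of integration is shifted vertically within the strip. -/
theorem intervalIntegral_eq_shift_of_differentiableOn_strip {a y u v : ℝ} (hy : |y| < a)
    {G : ℂ → ℂ} (hG : DifferentiableOn ℂ G {z : ℂ | |z.im| < a})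
    (hper : ∀ z : ℂ, |z.im| < a → G (z + (v - u : ℝ)) = G z) :
    ∫ x : ℝ in u..v, G x = ∫ x : ℝ in u..v, G (x + y * I) := by
  have hseg : ∀ t ∈ Set.uIcc 0 y, |t| < a := fun t ht => by
    have := Set.abs_sub_left_of_mem_uIcc ht
    simp only [sub_zero] at this
    exact this.trans_lt hy
  have hrect := integral_boundary_rect_eq_zero_of_differentiableOn G (u : ℂ) (v + y * I)
    (hG.mono fun z hz => hseg _ (by simpa using hz.2))
  have hsides : ∫ t : ℝ in 0..y, G (v + t * I) = ∫ t : ℝ in 0..y, G (u + t * I) := by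
    refine intervalIntegral.integral_congr fun t ht => ?_
    have h := hper (u + t * I) (by simpa using hseg t ht)
    rw [← h]
    push_cast
    ring_nf
  simp only [add_re, add_im, ofReal_re, ofReal_im, mul_re, mul_im, I_re, I_im, mul_zero, mul_one,
    sub_zero, add_zero, zero_add, ofReal_zero, zero_mul, hsides, add_sub_cancel_right] at hrect
  exact sub_eq_zero.mp hrect

theorem norm_exp_neg_I_mul_int_mul (k : ℤ) (z : ℂ) :
    ‖Complex.exp (-I * k * z)‖ = Real.exp (k * z.im) := by
  rw [Complex.norm_exp]
  simp

theorem exp_neg_I_mul_int_mul_add_two_pi (k : ℤ) (z : ℂ) :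
    Complex.exp (-I * k * (z + 2 * π)) = Complex.exp (-I * k * z) :=
  Complex.exp_eq_exp_iff_exists_int.mpr ⟨-k, by push_cast; ring⟩

/-- **Analyticity on a strip implies exponential spectral decay.** Let `F : ℂ → ℂ` be
holomorphic on the strip `S = {z : |Im z| < a}`, `2π`-periodic on `S`, and bounded by `M`
on `S`. Then the Fourier coefficients of its restriction `f` to `ℝ` satisfy
`|f̂(k)| ≤ M e^{-b|k|}` for every `0 < b < a` and every `k ∈ ℤ`. -/
theorem fourierCoef_exp_decay_of_holomorphic_strip
    (a M : ℝ) (ha : 0 < a) (F : ℂ → ℂ)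
    (hF : DifferentiableOn ℂ F {z : ℂ | |z.im| < a})
    (hper : ∀ z : ℂ, |z.im| < a → F (z + 2 * Real.pi) = F z)
    (hbound : ∀ z : ℂ, |z.im| < a → ‖F z‖ ≤ M) :
    ∀ b : ℝ, 0 < b → b < a →
      ∀ k : ℤ, ‖fourierCoef (fun θ : ℝ => F θ) k‖ ≤ M * Real.exp (-b * |k|) := by
  intro b hb hba k
  obtain ⟨y, hy, hky⟩ : ∃ y : ℝ, |y| < a ∧ k * y = -b * |(k : ℝ)| := by
    have hb' : |b| < a := by rwa [abs_of_pos hb]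
    rcases le_total 0 (k : ℝ) with hk | hk
    · exact ⟨-b, by rwa [abs_neg], by rw [abs_of_nonneg hk]; ring⟩
    · exact ⟨b, hb', by rw [abs_of_nonpos hk]; ring⟩
  have hshift := intervalIntegral_eq_shift_of_differentiableOn_strip (u := -π) (v := π) hy
    (G := fun z => F z * Complex.exp (-I * k * z))
    (hF.mul (by fun_prop)) fun z hz => by
      have hT : ((π - -π : ℝ) : ℂ) = 2 * π := by push_cast; ring
      simp only [hT, hper z hz, exp_neg_I_mul_int_mul_add_two_pi]
  have hint : ‖∫ x : ℝ in -π..π, F (x + y * I) * Complex.exp (-I * k * (x + y * I))‖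
      ≤ M * Real.exp (-b * |(k : ℝ)|) * |π - -π| := by
    refine intervalIntegral.norm_integral_le_of_norm_le_const fun x _ => ?_
    rw [norm_mul, norm_exp_neg_I_mul_int_mul]
    have him : ((x : ℂ) + y * I).im = y := by simp
    rw [him, hky]
    gcongr
    exact hbound _ (by rwa [him])
  have hpi : ‖(1 / (2 * π : ℂ))‖ = 1 / (2 * π) := by
    simp [abs_of_pos pi_pos]
  have hlen : |π - -π| = 2 * π := by
    rw [sub_neg_eq_add, ← two_mul, abs_of_pos two_pi_pos]
  rw [hlen] at hint
  rw [fourierCoef, hshift, norm_mul, hpi, one_div_mul_eq_div, div_le_iff₀ two_pi_pos]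
  simpa using hint
end

section
/- Let a > 0 and let F : ℂ → ℂ be holomorphic on the strip S = {z ∈ ℂ : |Im z| < a}. Assume that for every b with 0 < b < a, sup_{|y|≤b} ∫_ℝ |F(x + iy)| dx < ∞, and that F(x + iy) → 0 as |x| → ∞ uniformly for |y| ≤ b. Let f be the restriction of F to ℝ and let f̂(ω) = ∫_ℝ f(x) e^{−iωx} dx be its Fourier transform. Then for every b with 0 < b < a there is a constant C_b such that |f̂(ω)| ≤ C_b e^{−b|ω|} for all ω ∈ ℝ. -/
open MeasureTheory Real Complex

open Filter Topology in
/-- The integral of a function over the vertical segments `u T + i[0, c]` tends to zero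
if `|u T| → ∞` and the function is uniformly small far out in the strip. -/
theorem tendsto_integral_vertical_segment_zero {G : ℂ → ℂ} {c : ℝ} {u : ℝ → ℝ}
    (hu : Tendsto (fun T => |u T|) atTop atTop)
    (hdecay : ∀ ε : ℝ, 0 < ε → ∃ R : ℝ, ∀ x y : ℝ, y ∈ Set.uIcc 0 c → R ≤ |x| →
      ‖G (x + y * I)‖ < ε) :
    Tendsto (fun T : ℝ => ∫ y : ℝ in 0..c, G (u T + y * I)) atTop (𝓝 0) := by
  rw [Metric.tendsto_nhds]
  intro ε hε
  obtain ⟨R, hR⟩ := hdecay (ε / (|c| + 1)) (by positivity)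
  filter_upwards [hu.eventually_ge_atTop R] with T hT
  have hle : ‖∫ y : ℝ in 0..c, G (u T + y * I)‖ ≤ ε / (|c| + 1) * |c - 0| :=
    intervalIntegral.norm_integral_le_of_norm_le_const fun y hy =>
      (hR (u T) y (Set.uIoc_subset_uIcc hy) hT).le
  rw [sub_zero] at hle
  rw [dist_zero_right]
  refine hle.trans_lt ?_
  rw [div_mul_eq_mul_div, div_lt_iff₀ (by positivity)]
  nlinarith [abs_nonneg c]

open Filter Topology in
/-- Contour shift: the integral of a holomorphic function over a horizontal line does not change
when the line is moved within a strip in which the function decays uniformly. -/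
theorem integral_eq_integral_add_mul_I_of_differentiableOn {G : ℂ → ℂ} {c : ℝ}
    (hG : DifferentiableOn ℂ G {z : ℂ | z.im ∈ Set.uIcc 0 c})
    (h0 : Integrable fun x : ℝ => G x) (hc : Integrable fun x : ℝ => G (x + c * I))
    (hdecay : ∀ ε : ℝ, 0 < ε → ∃ R : ℝ, ∀ x y : ℝ, y ∈ Set.uIcc 0 c → R ≤ |x| →
      ‖G (x + y * I)‖ < ε) :
    ∫ x : ℝ, G x = ∫ x : ℝ, G (x + c * I) := by
  have hrect (T : ℝ) : (∫ x : ℝ in -T..T, G x) - (∫ x : ℝ in -T..T, G (x + c * I)) +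
      I • (∫ y : ℝ in 0..c, G (T + y * I)) -
      I • (∫ y : ℝ in 0..c, G ((-T : ℝ) + y * I)) = 0 := by
    have h := integral_boundary_rect_eq_zero_of_differentiableOn G ((-T : ℝ) : ℂ) (T + c * I)
      (hG.mono fun z hz => by simpa using hz.2)
    simpa using h
  have hlim := (((intervalIntegral_tendsto_integral h0 tendsto_neg_atTop_atBot tendsto_id).sub
    (intervalIntegral_tendsto_integral hc tendsto_neg_atTop_atBot tendsto_id)).add
    ((tendsto_integral_vertical_segment_zero (u := fun T => T)
      tendsto_abs_atTop_atTop hdecay).const_smul I)).sub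
    ((tendsto_integral_vertical_segment_zero (u := fun T => -T)
      (by simpa using tendsto_abs_atTop_atTop) hdecay).const_smul I)
  have heq := tendsto_nhds_unique hlim (tendsto_const_nhds.congr fun T => (hrect T).symm)
  simpa [sub_eq_zero] using heq

theorem norm_cexp_neg_I_mul_add_mul_I (ω x y : ℝ) :
    ‖cexp (-I * ω * (x + y * I))‖ = Real.exp (ω * y) := by
  rw [Complex.norm_exp]
  simp

/-- **Paley–Wiener-type exponential decay.** Let `F : ℂ → ℂ` be holomorphic on the strip
`S = {z : |Im z| < a}`. Suppose that for every `0 < b < a`, `x ↦ F(x + iy)` is integrable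
on `ℝ` with uniformly bounded `L¹` norms for `|y| ≤ b`, and `F(x + iy) → 0` as `|x| → ∞`
uniformly in `|y| ≤ b`. Then for every `0 < b < a` there is a constant `C_b` such that the
Fourier transform `f̂(ω) = ∫ f(x) e^{-iωx} dx` of the restriction `f = F|_ℝ` satisfies
`|f̂(ω)| ≤ C_b e^{-b|ω|}` for all `ω ∈ ℝ`. -/
theorem fourier_transform_exp_decay_of_holomorphic_strip
    (a : ℝ) (ha : 0 < a) (F : ℂ → ℂ)
    (hF : DifferentiableOn ℂ F {z : ℂ | |z.im| < a})
    (hint : ∀ b : ℝ, 0 < b → b < a →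
      ∀ y : ℝ, |y| ≤ b → MeasureTheory.Integrable (fun x : ℝ => F (x + y * Complex.I)))
    (hintBound : ∀ b : ℝ, 0 < b → b < a →
      ∃ B : ℝ, ∀ y : ℝ, |y| ≤ b → (∫ x : ℝ, ‖F (x + y * Complex.I)‖) ≤ B)
    (hdecay : ∀ b : ℝ, 0 < b → b < a →
      ∀ ε : ℝ, 0 < ε → ∃ R : ℝ, ∀ x y : ℝ, |y| ≤ b → R ≤ |x| →
        ‖F (x + y * Complex.I)‖ < ε) :
    ∀ b : ℝ, 0 < b → b < a →
      ∃ C : ℝ, ∀ ω : ℝ,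
        ‖∫ x : ℝ, F (x : ℂ) * Complex.exp (-Complex.I * ω * x)‖ ≤ C * Real.exp (-b * |ω|) := by
  intro b hb hba
  obtain ⟨B, hB⟩ := hintBound b hb hba
  refine ⟨B, fun ω => ?_⟩
  obtain ⟨c, hcb, hcω⟩ : ∃ c : ℝ, |c| = b ∧ ω * c = -b * |ω| := by
    rcases le_total 0 ω with h | h
    · exact ⟨-b, by rw [abs_neg, abs_of_pos hb], by rw [abs_of_nonneg h]; ring⟩
    · exact ⟨b, abs_of_pos hb, by rw [abs_of_nonpos h]; ring⟩
  have habs {y : ℝ} (hy : y ∈ Set.uIcc 0 c) : |y| ≤ b := by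
    simpa [hcb] using Set.abs_sub_left_of_mem_uIcc hy
  have hintegrable {y : ℝ} (hy : |y| ≤ b) :
      Integrable fun x : ℝ => F (x + y * I) * cexp (-I * ω * (x + y * I)) :=
    (hint b hb hba y hy).mul_bdd (c := Real.exp (ω * y))
      (Continuous.aestronglyMeasurable (by fun_prop))
      (.of_forall fun x => (norm_cexp_neg_I_mul_add_mul_I ω x y).le)
  have hshift := integral_eq_integral_add_mul_I_of_differentiableOn (c := c)
    (G := fun z => F z * cexp (-I * ω * z))
    ((hF.mono fun z hz => (habs hz).trans_lt hba).mul (by fun_prop))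
    (by simpa using hintegrable (y := 0) (by simpa using hb.le))
    (hintegrable hcb.le)
    (fun ε hε => by
      obtain ⟨R, hR⟩ := hdecay b hb hba (ε / Real.exp (|ω| * b)) (by positivity)
      refine ⟨R, fun x y hy hx => ?_⟩
      rw [norm_mul, norm_cexp_neg_I_mul_add_mul_I]
      have hexp : Real.exp (ω * y) ≤ Real.exp (|ω| * b) := by
        rw [Real.exp_le_exp]
        exact (le_abs_self _).trans
          ((abs_mul ω y).le.trans (mul_le_mul_of_nonneg_left (habs hy) (abs_nonneg ω)))
      calc ‖F (x + y * I)‖ * Real.exp (ω * y)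
          ≤ ‖F (x + y * I)‖ * Real.exp (|ω| * b) := by gcongr
        _ < ε := (lt_div_iff₀ (Real.exp_pos _)).1 (hR x y (habs hy) hx))
  rw [hshift]
  calc ‖∫ x : ℝ, F (x + c * I) * cexp (-I * ω * (x + c * I))‖
      ≤ ∫ x : ℝ, ‖F (x + c * I) * cexp (-I * ω * (x + c * I))‖ := norm_integral_le_integral_norm _
    _ = (∫ x : ℝ, ‖F (x + c * I)‖) * Real.exp (-b * |ω|) := by
      simp_rw [norm_mul, norm_cexp_neg_I_mul_add_mul_I, hcω]
      exact integral_mul_const _ _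
    _ ≤ B * Real.exp (-b * |ω|) := by
      gcongr
      exact hB c hcb.le
end
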